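/- Let G be 3-edge-connected with DFS tree T rooted at r, and let u, v be vertices with v ≠ r, u a descendant of v, B(u) = B(v) ⊔ {e} for a back-edge e, and M(u) = M(v). Then v = nextM(u), i.e., there is no vertex v' with M(v') = M(u) and v < v' < u, and the lower end of e equals low_M(u). -/

import Mathlib

/-- An undirected multigraph `G` (parallel edges allowed, no self-loops) together with a
DFS spanning tree `T` rooted at `root`, where the vertices are identified with their DFS
preorder numbers (so they are `Fin n`, and the root gets the smallest number).
Tree edges are oriented from child to parent and back-edges from descendant to
(proper) ancestor. -/
structure DFSGraph where
  /-- number of vertices; the vertices are `Fin n`, numbered in DFS preorder -/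
  n : ℕ
  /-- the type indexing the edges (parallel edges are allowed) -/
  Edge : Type
  edgeFintype : Fintype Edge
  /-- the first endpoint (the descendant end) of each edge -/
  fst : Edge → Fin n
  /-- the second endpoint (the ancestor end) of each edge -/
  snd : Edge → Fin n
  /-- no self-loops -/
  noloop : ∀ e, fst e ≠ snd e
  /-- the root `r` of the DFS tree -/
  root : Fin n
  /-- in DFS preorder the root gets the smallest number -/
  root_le : ∀ v, root ≤ v
  /-- the parent function `p` of the DFS tree (arbitrary at the root) -/
  parent : Fin n → Fin n
  /-- the parent of a non-root vertex precedes it in preorder -/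
  parent_lt : ∀ v, v ≠ root → parent v < v
  /-- `tEdge v` is the tree edge `(v, p(v))`, for `v ≠ root` -/
  tEdge : Fin n → Edge
  tEdge_fst : ∀ v, v ≠ root → fst (tEdge v) = v
  tEdge_snd : ∀ v, v ≠ root → snd (tEdge v) = parent v
  tEdge_inj : ∀ u v, u ≠ root → v ≠ root → tEdge u = tEdge v → u = v
  /-- DFS property: every non-tree edge is a back-edge, i.e. it joins a vertex to an
  ancestor of it (a proper ancestor, by `noloop`) -/
  back_anc : ∀ e, (¬ ∃ v, v ≠ root ∧ e = tEdge v) →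
    Relation.ReflTransGen (fun x y => x ≠ root ∧ y = parent x) (fst e) (snd e)
  /-- preorder property: the descendants of any vertex form an interval of preorder
  numbers starting at that vertex -/
  preorder_interval : ∀ v u w : Fin n, v ≤ u → u ≤ w →
    Relation.ReflTransGen (fun x y => x ≠ root ∧ y = parent x) w v →
    Relation.ReflTransGen (fun x y => x ≠ root ∧ y = parent x) u v

namespace DFSGraph

variable (G : DFSGraph)

/-- `Anc a b`: `a` is an ancestor of `b` in `T` (every vertex is an ancestor of itself). -/
def Anc (a b : Fin G.n) : Prop :=
  Relation.ReflTransGen (fun x y => x ≠ G.root ∧ y = G.parent x) b a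

/-- `PAnc a b`: `a` is a proper ancestor of `b` in `T`. -/
def PAnc (a b : Fin G.n) : Prop := G.Anc a b ∧ a ≠ b

/-- `e` is an edge of the spanning tree `T`. -/
def IsTreeEdge (e : G.Edge) : Prop := ∃ v, v ≠ G.root ∧ e = G.tEdge v

/-- `e` is a back-edge (an edge of `G ∖ T`). -/
def IsBack (e : G.Edge) : Prop := ¬ G.IsTreeEdge e

/-- `B v`: the set of back-edges `(x, y)` with `x` a descendant of `v` and `y` a proper
ancestor of `v`. -/
def B (v : Fin G.n) : Set G.Edge :=
  {e | G.IsBack e ∧ G.Anc v (G.fst e) ∧ G.PAnc (G.snd e) v}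

/-- `b_count(v) = |B(v)|`. -/
noncomputable def bcount (v : Fin G.n) : ℕ := (G.B v).ncard

/-- adjacency in `G` after removing the edge set `S` -/
def AdjOff (S : Set G.Edge) (x y : Fin G.n) : Prop :=
  ∃ e, e ∉ S ∧ ((G.fst e = x ∧ G.snd e = y) ∨ (G.fst e = y ∧ G.snd e = x))

/-- `G ∖ S` is connected -/
def ConnectedOff (S : Set G.Edge) : Prop :=
  ∀ x y, Relation.ReflTransGen (G.AdjOff S) x y

/-- `S` is an edge cut of `G`: removing `S` disconnects `G`. -/
def IsCut (S : Set G.Edge) : Prop := ¬ G.ConnectedOff S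

/-- `G` is `k`-edge-connected: it has no cut of fewer than `k` edges. -/
def EdgeConn (k : ℕ) : Prop := ∀ S : Set G.Edge, S.ncard < k → ¬ G.IsCut S

/-- `IsLow1 v y`: `y = low1(v) = min {y | ∃ (x,y) ∈ B(v)}`. -/
def IsLow1 (v y : Fin G.n) : Prop :=
  (∃ e ∈ G.B v, G.snd e = y) ∧ ∀ e ∈ G.B v, y ≤ G.snd e

/-- `IsHigh v y`: `y = high(v) = max {y | ∃ (x,y) ∈ B(v)}`. -/
def IsHigh (v y : Fin G.n) : Prop :=
  (∃ e ∈ G.B v, G.snd e = y) ∧ ∀ e ∈ G.B v, G.snd e ≤ y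

/-- `IsLow2 v y`: `y = low2(v)`, the minimum lower end of the back-edges in `B(v)` minus
one (fixed, but arbitrary) back-edge `(low1D(v), low1(v))` attaining `low1(v)`. -/
def IsLow2 (v y : Fin G.n) : Prop :=
  ∃ f ∈ G.B v, (∀ g ∈ G.B v, G.snd f ≤ G.snd g) ∧
    (∃ e ∈ G.B v, e ≠ f ∧ G.snd e = y) ∧
    (∀ e ∈ G.B v, e ≠ f → y ≤ G.snd e)

/-- `IsL1 v y`: `y = l1(v) = min ({y | (v,y) is a back-edge} ∪ {v})`. -/
def IsL1 (v y : Fin G.n) : Prop :=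
  (y = v ∨ ∃ e, G.IsBack e ∧ G.fst e = v ∧ G.snd e = y) ∧
  y ≤ v ∧ (∀ e, G.IsBack e → G.fst e = v → y ≤ G.snd e)

/-- `IsL2 v y`: `y = l2(v)`, defined as `l1(v)` but after removing one (fixed, but
arbitrary) back-edge `(v, l1(v))` attaining `l1(v)`, if such a back-edge exists. -/
def IsL2 (v y : Fin G.n) : Prop :=
  ((¬ ∃ e, G.IsBack e ∧ G.fst e = v) ∧ y = v) ∨
  (∃ f, G.IsBack f ∧ G.fst f = v ∧
    (∀ g, G.IsBack g → G.fst g = v → G.snd f ≤ G.snd g) ∧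
    (y = v ∨ ∃ e, G.IsBack e ∧ G.fst e = v ∧ e ≠ f ∧ G.snd e = y) ∧
    y ≤ v ∧
    (∀ e, G.IsBack e → G.fst e = v → e ≠ f → y ≤ G.snd e))

/-- `z` is the nearest common ancestor of the set of vertices `S`. -/
def IsNCA (S : Set (Fin G.n)) (z : Fin G.n) : Prop :=
  (∀ x ∈ S, G.Anc z x) ∧ ∀ z', (∀ x ∈ S, G.Anc z' x) → G.Anc z' z

/-- `IsM v m`: `m = M(v)`, the nearest common ancestor of all higher ends of back-edges
in `B(v)`. -/
def IsM (v m : Fin G.n) : Prop :=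
  G.IsNCA {x | ∃ e ∈ G.B v, G.fst e = x} m

/-- `IsMtilde v m`: `m = M̃(v)`, the nearest common ancestor of all higher ends of
back-edges in `B(v)` that are proper descendants of `M(v)` (defined only if such a
higher end exists). -/
def IsMtilde (v m : Fin G.n) : Prop :=
  ∃ mv, G.IsM v mv ∧
    {x | ∃ e ∈ G.B v, G.fst e = x ∧ G.PAnc mv x}.Nonempty ∧
    G.IsNCA {x | ∃ e ∈ G.B v, G.fst e = x ∧ G.PAnc mv x} m

/-- `c` is a child of `p` in `T`. -/
def IsChild (p c : Fin G.n) : Prop := c ≠ G.root ∧ G.parent c = p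

/-- `low1(c) ≤ low1(c')` (stated relationally). -/
def Low1LE (c c' : Fin G.n) : Prop :=
  ∀ y y', G.IsLow1 c y → G.IsLow1 c' y' → y ≤ y'

/-- `c = c₁(p)`: `c` is a `low1` child of `p`, i.e. a child of `p` minimizing `low1`. -/
def IsC1 (p c : Fin G.n) : Prop :=
  G.IsChild p c ∧ ∀ c', G.IsChild p c' → G.Low1LE c c'

/-- `c = c₂(p)`: `c` is a `low2` child of `p`, i.e. a child of `p` minimizing `low1`
among the children different from the (fixed) `low1` child. -/
def IsC2 (p c : Fin G.n) : Prop :=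
  ∃ c1, G.IsC1 p c1 ∧ G.IsChild p c ∧ c ≠ c1 ∧
    ∀ c', G.IsChild p c' → c' ≠ c1 → G.Low1LE c c'

/-- `c = c₃(p)`: `c` is a `low3` child of `p`. -/
def IsC3 (p c : Fin G.n) : Prop :=
  ∃ c1 c2, G.IsC1 p c1 ∧
    (G.IsChild p c2 ∧ c2 ≠ c1 ∧ ∀ c', G.IsChild p c' → c' ≠ c1 → G.Low1LE c2 c') ∧
    G.IsChild p c ∧ c ≠ c1 ∧ c ≠ c2 ∧
    (∀ c', G.IsChild p c' → c' ≠ c1 → c' ≠ c2 → G.Low1LE c c')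

/-- `IsMlow1 v m`: `m = M_low1(v)`, the nearest common ancestor of all higher ends of
back-edges in `B(v)` that are descendants of the `low1` child of `M(v)` (defined only
if such a higher end exists). -/
def IsMlow1 (v m : Fin G.n) : Prop :=
  ∃ mv c1, G.IsM v mv ∧ G.IsC1 mv c1 ∧
    {x | ∃ e ∈ G.B v, G.fst e = x ∧ G.Anc c1 x}.Nonempty ∧
    G.IsNCA {x | ∃ e ∈ G.B v, G.fst e = x ∧ G.Anc c1 x} m

/-- `IsMlow2 v m`: `m = M_low2(v)`, the nearest common ancestor of all higher ends of
back-edges in `B(v)` that are descendants of the `low2` child of `M(v)` (defined only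
if such a higher end exists). -/
def IsMlow2 (v m : Fin G.n) : Prop :=
  ∃ mv c2, G.IsM v mv ∧ G.IsC2 mv c2 ∧
    {x | ∃ e ∈ G.B v, G.fst e = x ∧ G.Anc c2 x}.Nonempty ∧
    G.IsNCA {x | ∃ e ∈ G.B v, G.fst e = x ∧ G.Anc c2 x} m

/-- `IsNextM v w`: `w = nextM(v)`, the maximum vertex `w < v` with `M(w) = M(v)`. -/
def IsNextM (v w : Fin G.n) : Prop :=
  ∃ m, G.IsM v m ∧ G.IsM w m ∧ w < v ∧ ∀ w', w' < v → G.IsM w' m → w' ≤ w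

/-- `IsLowM v l`: `l = low_M(v) = min {y | ∃ (x,y) ∈ B(v) ∖ B(nextM(v))}`. -/
def IsLowM (v l : Fin G.n) : Prop :=
  ∃ w, G.IsNextM v w ∧ (∃ e ∈ G.B v, e ∉ G.B w ∧ G.snd e = l) ∧
    ∀ e ∈ G.B v, e ∉ G.B w → l ≤ G.snd e

end DFSGraph

namespace DFSGraph

variable {G : DFSGraph}

theorem Anc.le {a b : Fin G.n} (h : G.Anc a b) : a ≤ b := by
  unfold Anc at h
  induction h with
  | refl => exact le_rfl
  | tail _ hs ih =>
    obtain ⟨hr, rfl⟩ := hs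
    exact (G.parent_lt _ hr).le.trans ih

theorem Anc.trans {a b c : Fin G.n} (hab : G.Anc a b) (hbc : G.Anc b c) : G.Anc a c :=
  Relation.ReflTransGen.trans hbc hab

/-- Two ancestors of a common vertex are comparable, in the order of their preorder numbers. -/
theorem Anc.of_le {a b x : Fin G.n} (hab : a ≤ b) (ha : G.Anc a x) (hb : G.Anc b x) :
    G.Anc a b :=
  G.preorder_interval a b x hab hb.le ha

theorem anc_parent_iff {a c : Fin G.n} (hc : c ≠ G.root) (hac : a ≠ c) :
    G.Anc a (G.parent c) ↔ G.Anc a c := by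
  refine ⟨fun h => Relation.ReflTransGen.head ⟨hc, rfl⟩ h, fun h => ?_⟩
  obtain h | ⟨d, ⟨_, rfl⟩, hd⟩ := Relation.ReflTransGen.cases_head h
  · exact absurd h.symm hac
  · exact hd

theorem not_anc_root {a : Fin G.n} (ha : a ≠ G.root) : ¬ G.Anc a G.root :=
  fun h => ha (le_antisymm h.le (G.root_le a))

/-- The edges leaving the subtree of `a` are the tree edge `(a, p(a))` and those of `B a`. -/
theorem anc_fst_iff_anc_snd {a : Fin G.n} {f : G.Edge} (hf : f ≠ G.tEdge a) (hfa : f ∉ G.B a) :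
    G.Anc a (G.fst f) ↔ G.Anc a (G.snd f) := by
  by_cases ht : G.IsTreeEdge f
  · obtain ⟨c, hc, rfl⟩ := ht
    rw [G.tEdge_fst c hc, G.tEdge_snd c hc]
    exact (anc_parent_iff hc (fun h => hf (h ▸ rfl))).symm
  · have hanc : G.Anc (G.snd f) (G.fst f) := G.back_anc f ht
    refine ⟨fun h => ?_, fun h => h.trans hanc⟩
    by_contra hn
    have hle : G.snd f ≤ a := by
      by_contra hlt
      exact hn (h.of_le (not_le.1 hlt).le hanc)
    exact hfa ⟨ht, h, hanc.of_le hle h, fun heq => hn (heq ▸ Relation.ReflTransGen.refl)⟩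

theorem anc_fst_of_mem_B {a : Fin G.n} {f : G.Edge} (hf : f ∈ G.B a) : G.Anc a (G.fst f) :=
  hf.2.1

theorem not_anc_snd_of_mem_B {a : Fin G.n} {f : G.Edge} (hf : f ∈ G.B a) :
    ¬ G.Anc a (G.snd f) :=
  fun h => hf.2.2.2 (le_antisymm hf.2.2.1.le h.le)

/-- Two tree edges crossed by the same back-edges form a cut. -/
theorem isCut_of_B_eq {a b : Fin G.n} (ha : a ≠ G.root) (hb : b ≠ G.root) (hab : a < b)
    (hB : G.B a = G.B b) : G.IsCut {G.tEdge a, G.tEdge b} := by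
  have key : ∀ f, f ∉ ({G.tEdge a, G.tEdge b} : Set G.Edge) →
      ((G.Anc a (G.fst f) ↔ G.Anc b (G.fst f)) ↔ (G.Anc a (G.snd f) ↔ G.Anc b (G.snd f))) := by
    intro f hf
    simp only [Set.mem_insert_iff, Set.mem_singleton_iff, not_or] at hf
    by_cases hfa : f ∈ G.B a
    · have hfb : f ∈ G.B b := hB ▸ hfa
      simp only [anc_fst_of_mem_B hfa, anc_fst_of_mem_B hfb, not_anc_snd_of_mem_B hfa,
        not_anc_snd_of_mem_B hfb]
    · have hfb : f ∉ G.B b := hB ▸ hfa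
      rw [anc_fst_iff_anc_snd hf.1 hfa, anc_fst_iff_anc_snd hf.2 hfb]
  have inv : ∀ y, Relation.ReflTransGen (G.AdjOff {G.tEdge a, G.tEdge b}) G.root y →
      (G.Anc a y ↔ G.Anc b y) := by
    intro y h
    induction h with
    | refl => exact iff_of_false (not_anc_root ha) (not_anc_root hb)
    | tail _ hs ih =>
      obtain ⟨f, hf, ⟨rfl, rfl⟩ | ⟨rfl, rfl⟩⟩ := hs
      · exact (key f hf).1 ih
      · exact (key f hf).2 ih
  intro hconn
  have hba : G.Anc b a := (inv a (hconn G.root a)).1 Relation.ReflTransGen.refl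
  exact absurd hba.le (not_le.2 hab)

theorem EdgeConn.B_ne (h3 : G.EdgeConn 3) {a b : Fin G.n} (ha : a ≠ G.root) (hab : a < b) :
    G.B a ≠ G.B b := by
  intro hB
  have hb : b ≠ G.root := ((G.root_le a).trans_lt hab).ne'
  have hcard := Set.ncard_insert_le (G.tEdge a) {G.tEdge b}
  rw [Set.ncard_singleton] at hcard
  exact h3 _ (by omega) (isCut_of_B_eq ha hb hab hB)

theorem IsM.anc {a m : Fin G.n} (h : G.IsM a m) : G.Anc a m :=
  h.2 a (by rintro _ ⟨f, hf, rfl⟩; exact hf.2.1)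

theorem IsM.B_subset {a b m : Fin G.n} (ha : G.IsM a m) (hb : G.Anc b m) (hab : G.Anc a b) :
    G.B a ⊆ G.B b := by
  intro f hf
  refine ⟨hf.1, hb.trans (ha.1 _ ⟨f, hf, rfl⟩), hf.2.2.1.trans hab, fun h => ?_⟩
  exact not_anc_snd_of_mem_B hf (h ▸ hab)

end DFSGraph

/-- Let `G` be `3`-edge-connected with DFS tree `T` rooted at `r`, and
let `u, v` be vertices with `v ≠ r`, `u` a descendant of `v`, `B(u) = B(v) ⊔ {e}` for a
back-edge `e`, and `M(u) = M(v)`. Then `v = nextM(u)`, i.e. there is no vertex `v'` with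
`M(v') = M(u)` and `v < v' < u`, and the lower end of `e` equals `low_M(u)`. -/
theorem stmt16 (G : DFSGraph) (h3 : G.EdgeConn 3) (u v m : Fin G.n)
    (hv : v ≠ G.root) (hanc : G.Anc v u) (e : G.Edge)
    (he : G.IsBack e) (hev : e ∉ G.B v) (hB : G.B u = insert e (G.B v))
    (hmu : G.IsM u m) (hmv : G.IsM v m) :
    G.IsNextM u v ∧ (¬ ∃ v', G.IsM v' m ∧ v < v' ∧ v' < u) ∧
      (∃ l, G.IsLowM u l ∧ G.snd e = l) := by
  have hvu : v < u := lt_of_le_of_ne hanc.le fun h => hev <| by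
    rw [h, hB]
    exact Set.mem_insert e _
  have hmax : ∀ w, w < u → G.IsM w m → w ≤ v := by
    intro w hwu hw
    by_contra hvw
    rw [not_le] at hvw
    have hw0 : w ≠ G.root := ((G.root_le v).trans_lt hvw).ne'
    have h1 : G.B v ⊆ G.B w := hmv.B_subset hw.anc (hmv.anc.of_le hvw.le hw.anc)
    have h2 : G.B w ⊆ G.B u := hw.B_subset hmu.anc (hw.anc.of_le hwu.le hmu.anc)
    by_cases hew : e ∈ G.B w
    · exact h3.B_ne hw0 hwu (h2.antisymm (hB ▸ Set.insert_subset hew h1))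
    · rw [hB, Set.subset_insert_iff_of_notMem hew] at h2
      exact h3.B_ne hv hvw (h1.antisymm h2)
  have hnext : G.IsNextM u v := ⟨m, hmu, hmv, hvu, hmax⟩
  refine ⟨hnext, ?_, G.snd e, ⟨v, hnext, ⟨e, hB ▸ Set.mem_insert e _, hev, rfl⟩, ?_⟩, rfl⟩
  · rintro ⟨w, hw, hvw, hwu⟩
    exact absurd (hmax w hwu hw) (not_le.2 hvw)
  · intro f hf hfv
    rw [hB] at hf
    rw [hf.resolve_right hfv]
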